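/- Let d ≥ 2, let t ∈ T, let x ∈ C, and let u ∈ ℝ^d be a unit vector with u · (x − t) = 0. Then |u · e_d| ≤ √2/2. In other words, any unit vector orthogonal to the difference of a point in the cylinder C and a point in the disk T makes an angle of at least π/4 with e_d. -/

import Mathlib

open MeasureTheory Real
open scoped RealInnerProductSpace ENNReal

namespace GaussLB

noncomputable section

/-- Euclidean space `ℝ^d`. -/
abbrev Euc (d : ℕ) := EuclideanSpace ℝ (Fin d)

/-- The last coordinate index of `Fin d`. -/
def lastIdx (d : ℕ) [NeZero d] : Fin d := ⟨d - 1, Nat.sub_lt (NeZero.pos d) one_pos⟩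

/-- The last standard basis vector `e_d` of `ℝ^d`. -/
def eLast (d : ℕ) [NeZero d] : Euc d := EuclideanSpace.single (lastIdx d) 1

/-- The disk `T = {(t,0) : t ∈ ℝ^{d−1}, ‖t‖ ≤ 1/2}`. -/
def diskT (d : ℕ) [NeZero d] : Set (Euc d) :=
  {x | x (lastIdx d) = 0 ∧ ‖x‖ ≤ 1/2}

/-- The cylinder `C = {(t,λ) : t ∈ ℝ^{d−1}, ‖t‖ ≤ 1/2, λ ∈ [1,2]}`. -/
def cylC (d : ℕ) [NeZero d] : Set (Euc d) :=
  {x | x (lastIdx d) ∈ Set.Icc (1:ℝ) 2 ∧ ‖x - x (lastIdx d) • eLast d‖ ≤ 1/2}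

/-- The spherical region `N = {u : ‖u‖ = 1, |u·e_d| ≤ √3/2}`. -/
def capN (d : ℕ) [NeZero d] : Set (Euc d) :=
  {u | ‖u‖ = 1 ∧ |⟪u, eLast d⟫| ≤ Real.sqrt 3 / 2}

/-- The Lebesgue density of the Gaussian `G(σ,t,u) = N(t, I_d − (1−σ²)·u uᵀ)`:
since `det Σ = σ²` and `Σ⁻¹ = I_d + (σ⁻² − 1)·u uᵀ`, it equals
`(2π)^{−d/2} σ⁻¹ exp(−(‖x−t‖² + (σ⁻²−1)⟪u, x−t⟫²)/2)`. -/
def gdens (d : ℕ) (σ : ℝ) (t u : Euc d) (x : Euc d) : ℝ :=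
  (2 * π) ^ (-(d:ℝ)/2) * σ⁻¹ *
    Real.exp (-(‖x - t‖^2 + ((σ^2)⁻¹ - 1) * ⟪u, x - t⟫^2) / 2)

/-- The Gaussian measure `G(σ,t,u) = N(t, I_d − (1−σ²)·u uᵀ)` on `ℝ^d`. -/
def gaussTU (d : ℕ) (σ : ℝ) (t u : Euc d) : Measure (Euc d) :=
  volume.withDensity fun x => ENNReal.ofReal (gdens d σ t u x)

/-- Normalization of a measure to a probability measure. -/
def normalize {Z : Type*} [MeasurableSpace Z] (μ : Measure Z) : Measure Z :=
  (μ Set.univ)⁻¹ • μ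

/-- The embedding `ℝ^{d−1} → ℝ^d` appending `0` as the last coordinate. -/
def emb (d : ℕ) : Euc (d-1) → Euc d := fun x =>
  (EuclideanSpace.equiv (Fin d) ℝ).symm
    (fun i => if h : (i : ℕ) < d - 1 then x ⟨i, h⟩ else 0)

/-- The uniform distribution on the disk `T`: the normalized `(d−1)`-dimensional
Lebesgue measure on the disk of radius `1/2`, embedded into the hyperplane of `ℝ^d`
spanned by the first `d−1` coordinates. -/
def uniformT (d : ℕ) : Measure (Euc d) :=
  normalize ((volume.restrict {x : Euc (d-1) | ‖x‖ ≤ 1/2}).map (emb d))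

/-- The uniform distribution on the spherical region `N`: the normalized cone
(surface) measure of `N`. -/
def uniformN (d : ℕ) [NeZero d] : Measure (Euc d) :=
  normalize ((volume.restrict
      {x : Euc d | 0 < ‖x‖ ∧ ‖x‖ ≤ 1 ∧ ‖x‖⁻¹ • x ∈ capN d}).map
    (fun x => ‖x‖⁻¹ • x))

/-- The uniform distribution on `T × N`. -/
def uniformTN (d : ℕ) [NeZero d] : Measure (Euc d × Euc d) :=
  (uniformT d).prod (uniformN d)

/-- Total variation distance between two measures. -/
def tv {Z : Type*} [MeasurableSpace Z] (p q : Measure Z) : ℝ :=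
  ⨆ B : {s : Set Z // MeasurableSet s}, |(p B).toReal - (q B).toReal|

end

/-- Any unit vector `u` orthogonal to the difference `x − t` of a point `x` in the
cylinder `C` and a point `t` in the disk `T` satisfies `|u·e_d| ≤ √2/2`, i.e. makes an
angle of at least `π/4` with `e_d`. -/
theorem angle_of_orthogonal_vector (d : ℕ) [NeZero d] (hd : 2 ≤ d)
    (t : Euc d) (ht : t ∈ diskT d) (x : Euc d) (hx : x ∈ cylC d)
    (u : Euc d) (hu : ‖u‖ = 1) (horth : ⟪u, x - t⟫ = 0) :
    |⟪u, eLast d⟫| ≤ Real.sqrt 2 / 2 := by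
  obtain ⟨ht0, ht1⟩ := ht
  obtain ⟨⟨hl1, -⟩, hx2⟩ := hx
  have hin : ∀ v : Euc d, ⟪v, eLast d⟫ = v (lastIdx d) := by
    intro v
    simp [eLast, EuclideanSpace.inner_single_right]
  have he : ‖eLast d‖ = 1 := by simp [eLast]
  have hee : ⟪eLast d, eLast d⟫ = 1 := by
    rw [real_inner_self_eq_norm_sq, he]; norm_num
  have hte := hin t
  have hxe := hin x
  rw [ht0] at hte
  set e := eLast d with hedef
  set l := x (lastIdx d) with hl
  set a := ⟪u, e⟫ with ha
  have hw : ‖(x - l • e) - t‖ ≤ 1 := (norm_sub_le _ _).trans (by linarith)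
  have huu : ⟪u, u⟫ = 1 := by rw [real_inner_self_eq_norm_sq, hu]; norm_num
  have hn : ‖u - a • e‖ ^ 2 = 1 - a ^ 2 := by
    rw [← real_inner_self_eq_norm_sq]
    simp only [inner_sub_left, inner_sub_right, real_inner_smul_left, real_inner_smul_right,
      real_inner_comm u e, huu, hee, ← ha]
    ring
  have hk : ⟪u - a • e, (x - l • e) - t⟫ = - (l * a) := by
    have h1 : ⟪e, x⟫ = l := by rw [real_inner_comm]; exact hxe
    have h2 : ⟪e, t⟫ = 0 := by rw [real_inner_comm]; exact hte
    rw [inner_sub_right] at horth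
    simp only [inner_sub_left, inner_sub_right, real_inner_smul_left, real_inner_smul_right,
      h1, h2, hee, ← ha]
    linear_combination horth
  have hcs := abs_real_inner_le_norm (u - a • e) ((x - l • e) - t)
  rw [hk, abs_neg] at hcs
  have hcs2 : |l * a| ≤ ‖u - a • e‖ :=
    hcs.trans (mul_le_of_le_one_right (norm_nonneg _) hw)
  have hsq : (l * a) ^ 2 ≤ 1 - a ^ 2 := by
    rw [← hn, ← sq_abs]
    exact pow_le_pow_left₀ (abs_nonneg _) hcs2 2
  have h2a : a ^ 2 ≤ (l * a) ^ 2 := by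
    have : 1 ≤ l ^ 2 := by nlinarith
    nlinarith [sq_nonneg a]
  apply abs_le_of_sq_le_sq _ (by positivity)
  rw [div_pow, Real.sq_sqrt (by norm_num)]
  linarith

end GaussLB
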